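/- arXiv:1510.03422 — 2 statements merged into one kernel-verified Lean document; each statement's English description precedes it below -/
import Mathlib

section
/- Let a, ρ, t, ω be rational numbers satisfying a^2*ρ^3*t^4 + (3*a*ρ^2 - 1)*t^2 + a*ρ^3 = ω^2. Define p = t*(a*ρ*t^2 + 1), q = ω, r = ω*t, s = t^2 + ρ. Then p*q*(p^2 + q^2) = a*r*s*(r^2 + s^2). -/
theorem stmt_5 (a ρ t ω : ℚ)
    (h : a ^ 2 * ρ ^ 3 * t ^ 4 + (3 * a * ρ ^ 2 - 1) * t ^ 2 + a * ρ ^ 3 = ω ^ 2)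
    (p q r s : ℚ) (hp : p = t * (a * ρ * t ^ 2 + 1)) (hq : q = ω)
    (hr : r = ω * t) (hs : s = t ^ 2 + ρ) :
    p * q * (p ^ 2 + q ^ 2) = a * r * s * (r ^ 2 + s ^ 2) := by
  subst hp hq hr hs
  linear_combination (-(q * t * (1 - a * t ^ 4))) * h
end

section
/- Let α and t be rational numbers with (2*α + 3)*t^2 + 1 ≠ 0, and set a = (α^2 + t^2)/((2*α + 3)*t^2 + 1). Then p = t*(a*t^2 + 1), q = a*t^2 - α, r = t*(a*t^2 - α), s = t^2 + 1 satisfy p*q*(p^2 + q^2) = a*r*s*(r^2 + s^2). -/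
theorem stmt_15 (α t : ℚ) (hden : (2 * α + 3) * t ^ 2 + 1 ≠ 0)
    (a : ℚ) (ha : a = (α ^ 2 + t ^ 2) / ((2 * α + 3) * t ^ 2 + 1))
    (p q r s : ℚ)
    (hp : p = t * (a * t ^ 2 + 1)) (hq : q = a * t ^ 2 - α)
    (hr : r = t * (a * t ^ 2 - α)) (hs : s = t ^ 2 + 1) :
    p * q * (p ^ 2 + q ^ 2) = a * r * s * (r ^ 2 + s ^ 2) := by
  have h : a * ((2 * α + 3) * t ^ 2 + 1) = α ^ 2 + t ^ 2 := by
    rw [ha]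
    exact div_mul_cancel₀ _ hden
  clear ha
  subst hp hq hr hs
  linear_combination (-(t * (a * t ^ 2 - α) * (1 - a * t ^ 4))) * h
end
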